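/- arXiv:1803.07305 — 4 statements merged into one kernel-verified Lean document; each statement's English description precedes it below -/
import Mathlib

section
/- Let L ≥ 3 be a natural number and for l = 1,…,L set θ_l = 2π(l−1)/L. Let α, β, φ be real numbers with β > 0 and φ ∈ (−π/2, π/2), and define the noiseless RSSI values R_l = α + β·cos(θ_l + φ) for l = 1,…,L. Then the phase estimator of Theorem 1 is exact: arctan( (−∑_{l=1}^{L} R_l·sin θ_l) / (∑_{l=1}^{L} R_l·cos θ_l) ) = φ. -/
open Real Finset

/-- The `k`-th powers of the `L`-th roots of unity sum to zero when `0 < k < L`. -/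
lemma sum_exp_mul_two_pi_div {L k : ℕ} (hk : 0 < k) (hkL : k < L) :
    ∑ l ∈ Finset.range L,
      Complex.exp (((k * (2 * π * (l : ℝ) / (L : ℝ)) : ℝ) : ℂ) * Complex.I) = 0 := by
  have hL : L ≠ 0 := by omega
  have hζ := Complex.isPrimitiveRoot_exp L hL
  set ζ := Complex.exp (2 * π * Complex.I / L) with hζ_def
  have hterm : ∀ l : ℕ,
      Complex.exp (((k * (2 * π * (l : ℝ) / (L : ℝ)) : ℝ) : ℂ) * Complex.I) = (ζ ^ k) ^ l := by
    intro l
    rw [hζ_def, ← Complex.exp_nat_mul, ← Complex.exp_nat_mul]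
    congr 1
    push_cast
    ring
  have hmul := mul_neg_geom_sum (ζ ^ k) L
  rw [← pow_mul, mul_comm k L, pow_mul, hζ.pow_eq_one, one_pow, sub_self] at hmul
  simp_rw [hterm]
  refine (mul_eq_zero.mp hmul).resolve_left ?_
  exact sub_ne_zero.mpr (hζ.pow_ne_one_of_pos_of_lt hk.ne' hkL).symm

lemma sum_cos_mul_two_pi_div {L k : ℕ} (hk : 0 < k) (hkL : k < L) :
    ∑ l ∈ Finset.range L, Real.cos (k * (2 * π * (l : ℝ) / (L : ℝ))) = 0 := by
  have h := congrArg Complex.re (sum_exp_mul_two_pi_div hk hkL)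
  simpa only [Complex.re_sum, Complex.exp_ofReal_mul_I_re, Complex.zero_re] using h

lemma sum_sin_mul_two_pi_div {L k : ℕ} (hk : 0 < k) (hkL : k < L) :
    ∑ l ∈ Finset.range L, Real.sin (k * (2 * π * (l : ℝ) / (L : ℝ))) = 0 := by
  have h := congrArg Complex.im (sum_exp_mul_two_pi_div hk hkL)
  simpa only [Complex.im_sum, Complex.exp_ofReal_mul_I_im, Complex.zero_im] using h

/-- Noiseless exactness of the arctan phase estimator of Theorem 1: with
`θ_l = 2π(l-1)/L`, `L ≥ 3`, `β > 0`, `φ ∈ (−π/2, π/2)` and noiseless RSSI values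
`R_l = α + β cos(θ_l + φ)`, one has
`arctan((−∑ R_l sin θ_l)/(∑ R_l cos θ_l)) = φ`. -/
theorem arctan_phase_estimator_exact (L : ℕ) (hL : 3 ≤ L) (α β φ : ℝ)
    (hβ : 0 < β) (hφ₁ : -(π / 2) < φ) (hφ₂ : φ < π / 2)
    (R : ℕ → ℝ)
    (hR : ∀ l ∈ Finset.range L, R l = α + β * Real.cos (2 * π * (l : ℝ) / (L : ℝ) + φ)) :
    Real.arctan
        ((-∑ l ∈ Finset.range L, R l * Real.sin (2 * π * (l : ℝ) / (L : ℝ))) /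
          (∑ l ∈ Finset.range L, R l * Real.cos (2 * π * (l : ℝ) / (L : ℝ)))) = φ := by
  have hc1 := sum_cos_mul_two_pi_div (L := L) one_pos (by omega)
  have hs1 := sum_sin_mul_two_pi_div (L := L) one_pos (by omega)
  have hc2 := sum_cos_mul_two_pi_div (L := L) two_pos (by omega)
  have hs2 := sum_sin_mul_two_pi_div (L := L) two_pos (by omega)
  simp only [Nat.cast_one, one_mul, Nat.cast_ofNat] at hc1 hs1 hc2 hs2
  have hcos : ∑ l ∈ Finset.range L, R l * Real.cos (2 * π * (l : ℝ) / (L : ℝ))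
      = L * (β / 2) * Real.cos φ := by
    have hterm : ∀ l ∈ Finset.range L, R l * Real.cos (2 * π * (l : ℝ) / (L : ℝ))
        = α * Real.cos (2 * π * (l : ℝ) / (L : ℝ))
          + β / 2 * Real.cos φ * Real.cos (2 * (2 * π * (l : ℝ) / (L : ℝ)))
          - β / 2 * Real.sin φ * Real.sin (2 * (2 * π * (l : ℝ) / (L : ℝ)))
          + β / 2 * Real.cos φ := by
      intro l hl
      rw [hR l hl, Real.cos_add, Real.cos_two_mul, Real.sin_two_mul]
      ring
    rw [Finset.sum_congr rfl hterm, Finset.sum_add_distrib, Finset.sum_sub_distrib,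
      Finset.sum_add_distrib, ← Finset.mul_sum, ← Finset.mul_sum, ← Finset.mul_sum,
      hc1, hc2, hs2, Finset.sum_const, Finset.card_range, nsmul_eq_mul]
    ring
  have hsin : ∑ l ∈ Finset.range L, R l * Real.sin (2 * π * (l : ℝ) / (L : ℝ))
      = -(L * (β / 2) * Real.sin φ) := by
    have hterm : ∀ l ∈ Finset.range L, R l * Real.sin (2 * π * (l : ℝ) / (L : ℝ))
        = α * Real.sin (2 * π * (l : ℝ) / (L : ℝ))
          + β / 2 * Real.cos φ * Real.sin (2 * (2 * π * (l : ℝ) / (L : ℝ)))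
          + β / 2 * Real.sin φ * Real.cos (2 * (2 * π * (l : ℝ) / (L : ℝ)))
          - β / 2 * Real.sin φ := by
      intro l hl
      rw [hR l hl, Real.cos_add, Real.cos_two_mul, Real.sin_two_mul]
      linear_combination (-β * Real.sin φ) *
        Real.sin_sq_add_cos_sq (2 * π * (l : ℝ) / (L : ℝ))
    rw [Finset.sum_congr rfl hterm, Finset.sum_sub_distrib, Finset.sum_add_distrib,
      Finset.sum_add_distrib, ← Finset.mul_sum, ← Finset.mul_sum, ← Finset.mul_sum,
      hs1, hs2, hc2, Finset.sum_const, Finset.card_range, nsmul_eq_mul]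
    ring
  have hL0 : (0 : ℝ) < L := by exact_mod_cast (by omega : 0 < L)
  have hne : (L : ℝ) * (β / 2) ≠ 0 := by positivity
  rw [hsin, hcos, neg_neg, mul_div_mul_left _ _ hne, ← Real.tan_eq_sin_div_cos]
  exact Real.arctan_tan hφ₁ hφ₂
end

section
/- Let L ≥ 3 be a natural number, for l = 1,…,L set θ_l = 2π(l−1)/L, and let R_1,…,R_L, α, β be real numbers. Define the least-squares error E(φ) = ∑_{l=1}^{L} ( R_l − (α + β·cos(θ_l + φ)) )². Then for every real φ, the derivative of E at φ equals 2β·∑_{l=1}^{L} R_l·sin(θ_l + φ); in particular the first-order optimality condition ∂E/∂φ = 0 is equivalent (when β ≠ 0) to ∑_{l=1}^{L} R_l·sin(θ_l + φ) = 0. -/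
open Real Finset

/-- A sinusoid whose frequency `k` is not a multiple of `L` sums to zero over `L` equally spaced
sampling angles. -/
theorem sum_sin_equally_spaced_eq_zero {L k : ℕ} (hL : L ≠ 0) (hk : ¬ L ∣ k) (φ : ℝ) :
    ∑ l ∈ Finset.range L, Real.sin (k * (2 * π * (l : ℝ) / (L : ℝ)) + φ) = 0 := by
  have hζ := Complex.isPrimitiveRoot_exp L hL
  set ζ := Complex.exp (2 * π * Complex.I / L) with hζ_def
  have hne : ζ ^ k ≠ 1 := fun h => hk (hζ.dvd_of_pow_eq_one k h)
  have hgeom : ∑ l ∈ Finset.range L, (ζ ^ k) ^ l = 0 := by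
    rw [geom_sum_eq hne, pow_right_comm, hζ.pow_eq_one, one_pow, sub_self, zero_div]
  have hterm (l : ℕ) : Real.sin (k * (2 * π * (l : ℝ) / (L : ℝ)) + φ) =
      (Complex.exp (φ * Complex.I) * (ζ ^ k) ^ l).im := by
    rw [← Complex.exp_ofReal_mul_I_im, hζ_def, ← Complex.exp_nat_mul, ← Complex.exp_nat_mul,
      ← Complex.exp_add]
    congr 2
    push_cast
    ring
  rw [Finset.sum_congr rfl fun l _ => hterm l, ← Complex.im_sum, ← Finset.mul_sum, hgeom, mul_zero,
    Complex.zero_im]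

/-- The derivative of the least-squares error
`E(φ) = ∑_{l=1}^{L} (R_l − (α + β cos(θ_l + φ)))²` (with `θ_l = 2π(l-1)/L`, `L ≥ 3`)
equals `2β ∑ R_l sin(θ_l + φ)` at every `φ`; in particular, when `β ≠ 0`, the
first-order condition `E'(φ) = 0` is equivalent to `∑ R_l sin(θ_l + φ) = 0`. -/
theorem deriv_lse_phase (L : ℕ) (hL : 3 ≤ L) (R : ℕ → ℝ) (α β : ℝ)
    (E : ℝ → ℝ)
    (hE : E = fun ψ => ∑ l ∈ Finset.range L,
      (R l - (α + β * Real.cos (2 * π * (l : ℝ) / (L : ℝ) + ψ))) ^ 2) :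
    ∀ φ : ℝ,
      HasDerivAt E
        (2 * β * ∑ l ∈ Finset.range L, R l * Real.sin (2 * π * (l : ℝ) / (L : ℝ) + φ)) φ ∧
      (β ≠ 0 →
        (deriv E φ = 0 ↔
          ∑ l ∈ Finset.range L, R l * Real.sin (2 * π * (l : ℝ) / (L : ℝ) + φ) = 0)) := by
  intro φ
  have hsin : ∑ l ∈ Finset.range L, Real.sin (2 * π * (l : ℝ) / (L : ℝ) + φ) = 0 := by
    simpa using sum_sin_equally_spaced_eq_zero (k := 1) (by omega : L ≠ 0)
      (Nat.not_dvd_of_pos_of_lt (by omega) (by omega)) φ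
  have hsin_two :
      ∑ l ∈ Finset.range L, Real.sin (2 * (2 * π * (l : ℝ) / (L : ℝ) + φ)) = 0 := by
    simpa [mul_add] using sum_sin_equally_spaced_eq_zero (k := 2) (by omega : L ≠ 0)
      (Nat.not_dvd_of_pos_of_lt (by omega) (by omega)) (2 * φ)
  have hderiv : HasDerivAt E
      (2 * β * ∑ l ∈ Finset.range L, R l * Real.sin (2 * π * (l : ℝ) / (L : ℝ) + φ)) φ := by
    have hsum : HasDerivAt E (∑ l ∈ Finset.range L,
        (2 * β * (R l * Real.sin (2 * π * (l : ℝ) / (L : ℝ) + φ)) -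
          2 * α * β * Real.sin (2 * π * (l : ℝ) / (L : ℝ) + φ) -
          β ^ 2 * Real.sin (2 * (2 * π * (l : ℝ) / (L : ℝ) + φ)))) φ := by
      rw [hE]
      refine HasDerivAt.fun_sum fun l _ => ?_
      convert! ((((((hasDerivAt_id φ).const_add (2 * π * (l : ℝ) / (L : ℝ))).cos).const_mul
        β).const_add α).const_sub (R l)).pow 2 using 1
      simp only [id, Real.sin_two_mul]
      ring
    simpa [Finset.sum_sub_distrib, ← Finset.mul_sum, hsin, hsin_two] using hsum
  refine ⟨hderiv, fun hβ => ?_⟩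
  rw [hderiv.deriv]
  simp [hβ]
end

section
/- Let K be a positive natural number, C a K×K complex positive semidefinite Hermitian matrix, h ∈ ℂ^K, ε > 0 and t ∈ ℝ. Then the robust constraint 'for every η ∈ ℂ^K with ‖η‖ ≤ ε one has (h+η)* C (h+η) ≥ t' holds if and only if there exists a real μ ≥ 0 such that the (K+1)×(K+1) Hermitian block matrix T(μ) = [[ μ·I_K + C , C h ], [ (C h)* , h* C h − t − μ·ε² ]] is positive semidefinite. -/
open Matrix Finset
open scoped ComplexOrder

/-- **Lagrange multipliers for convex functions** under Slater's condition: if the convex `f` is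
nonnegative wherever the convex `g` is nonpositive, and `g` takes a negative value, then
`f + μ g` is nonnegative everywhere for some `μ ≥ 0`. -/
theorem ConvexOn.exists_multiplier_of_slater {E : Type*} [AddCommGroup E] [Module ℝ E]
    {f g : E → ℝ} (hf : ConvexOn ℝ Set.univ f) (hg : ConvexOn ℝ Set.univ g)
    {x₀ : E} (hx₀ : g x₀ < 0) (hfg : ∀ x, g x ≤ 0 → 0 ≤ f x) :
    ∃ μ : ℝ, 0 ≤ μ ∧ ∀ x, 0 ≤ f x + μ * g x := by
  let S : Set ℝ := insert 0 {r | ∃ y, 0 < g y ∧ r = -f y / g y}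
  let T : Set ℝ := {r | ∃ x, g x < 0 ∧ r = f x / -g x}
  have hST : ∀ r ∈ S, ∀ r' ∈ T, r ≤ r' := by
    rintro r (rfl | ⟨y, hy, rfl⟩) r' ⟨x, hx, rfl⟩
    · exact div_nonneg (hfg x hx.le) (by linarith)
    · have hpos : 0 < g y - g x := by linarith
      have ha : 0 ≤ g y / (g y - g x) := by positivity
      have hb : 0 ≤ -g x / (g y - g x) := div_nonneg (by linarith) hpos.le
      have hab : g y / (g y - g x) + -g x / (g y - g x) = 1 := by
        field_simp
        ring
      have hgz := hg.2 (Set.mem_univ x) (Set.mem_univ y) ha hb hab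
      have hfz := hf.2 (Set.mem_univ x) (Set.mem_univ y) ha hb hab
      simp only [smul_eq_mul] at hgz hfz
      have hgz0 : g y / (g y - g x) * g x + -g x / (g y - g x) * g y = 0 := by
        field_simp
        ring
      have h0 := (hfg _ (hgz.trans hgz0.le)).trans hfz
      have h1 : g y / (g y - g x) * f x + -g x / (g y - g x) * f y
          = (g y * f x + -g x * f y) / (g y - g x) := by ring
      rw [h1, le_div_iff₀ hpos] at h0
      rw [div_le_div_iff₀ hy (by linarith)]
      linarith
  obtain ⟨μ, hμS, hμT⟩ := exists_between_of_forall_le (s := S) (t := T)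
    (Set.insert_nonempty _ _) ⟨_, x₀, hx₀, rfl⟩ hST
  refine ⟨μ, hμS (Set.mem_insert _ _), fun x => ?_⟩
  rcases lt_trichotomy (g x) 0 with hx | hx | hx
  · have := hμT ⟨x, hx, rfl⟩
    rw [le_div_iff₀ (by linarith)] at this
    linarith
  · simpa [hx] using hfg x hx.le
  · have := hμS (Set.mem_insert_of_mem _ ⟨x, hx, rfl⟩)
    rw [div_le_iff₀ hx] at this
    linarith

namespace Matrix

variable {n : Type*}

theorem IsHermitian.fromBlocks_border [DecidableEq n] {C : Matrix n n ℂ}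
    (hC : C.IsHermitian) (v : n → ℂ) (μ d : ℝ) :
    (Matrix.fromBlocks ((μ : ℂ) • (1 : Matrix n n ℂ) + C)
      (Matrix.of fun k (_ : Fin 1) => v k) (Matrix.of fun (_ : Fin 1) k => star (v k))
      (Matrix.of fun (_ : Fin 1) (_ : Fin 1) => (d : ℂ))).IsHermitian := by
  refine IsHermitian.fromBlocks ?_ ?_ ?_
  · simp [IsHermitian, hC.eq]
  · rfl
  · ext
    simp

variable [Fintype n]

theorem PosSemidef.convexOn_re_dotProduct_mulVec {C : Matrix n n ℂ} (hC : C.PosSemidef) :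
    ConvexOn ℝ Set.univ fun x : n → ℂ => (star x ⬝ᵥ C *ᵥ x).re := by
  refine ⟨convex_univ, fun x _ y _ a b ha hb hab => ?_⟩
  have hxy := (Complex.nonneg_iff.1 (hC.dotProduct_mulVec_nonneg (x - y))).1
  have hmul := mul_nonneg (mul_nonneg ha hb) hxy
  obtain rfl : b = 1 - a := by linarith
  simp only [star_add, star_sub, star_smul, star_trivial, mulVec_add, mulVec_sub, mulVec_smul,
    add_dotProduct, dotProduct_add, sub_dotProduct, dotProduct_sub, smul_dotProduct,
    dotProduct_smul, Complex.add_re, Complex.sub_re, Complex.smul_re, smul_eq_mul] at hmul ⊢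
  linarith

theorem star_dotProduct_self_eq_sum_norm_sq (x : n → ℂ) :
    star x ⬝ᵥ x = ((∑ k, ‖x k‖ ^ 2 : ℝ) : ℂ) := by
  simp [dotProduct, Complex.conj_mul']

theorem PosSemidef.coe_re_dotProduct_mulVec {C : Matrix n n ℂ} (hC : C.PosSemidef)
    (x : n → ℂ) : ((star x ⬝ᵥ C *ᵥ x).re : ℂ) = star x ⬝ᵥ C *ᵥ x :=
  Complex.ext rfl (Complex.nonneg_iff.1 (hC.dotProduct_mulVec_nonneg x)).2

theorem convexOn_sum_norm_sq : ConvexOn ℝ Set.univ fun x : n → ℂ => ∑ k, ‖x k‖ ^ 2 := by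
  classical
  simpa [star_dotProduct_self_eq_sum_norm_sq, -Complex.ofReal_sum, Complex.ofReal_re] using
    (PosSemidef.one (n := n) (R := ℂ)).convexOn_re_dotProduct_mulVec

/-- The quadratic form of the bordered matrix `[[μI + C, Ch], [(Ch)*, h*Ch − t − r]]`. -/
theorem IsHermitian.dotProduct_fromBlocks_mulVec [DecidableEq n] {C : Matrix n n ℂ}
    (hC : C.IsHermitian) (h y : n → ℂ) (μ t r s : ℂ) :
    star (Sum.elim y fun _ : Fin 1 => s) ⬝ᵥ
        Matrix.fromBlocks (μ • (1 : Matrix n n ℂ) + C)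
          (Matrix.of fun k (_ : Fin 1) => (C *ᵥ h) k)
          (Matrix.of fun (_ : Fin 1) k => star ((C *ᵥ h) k))
          (Matrix.of fun (_ : Fin 1) (_ : Fin 1) => star h ⬝ᵥ C *ᵥ h - t - r) *ᵥ
        (Sum.elim y fun _ : Fin 1 => s) =
      star (s • h + y) ⬝ᵥ C *ᵥ (s • h + y) + μ * (star y ⬝ᵥ y) - star s * s * (t + r) := by
  have hcol : (Matrix.of fun k (_ : Fin 1) => (C *ᵥ h) k) *ᵥ (fun _ => s) = s • C *ᵥ h := by
    ext k
    simp [mulVec, dotProduct, mul_comm]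
  have hrow : (Matrix.of fun (_ : Fin 1) k => star ((C *ᵥ h) k)) *ᵥ y
      = fun _ => star h ⬝ᵥ C *ᵥ y := by
    ext
    rw [dotProduct_mulVec, ← hC.eq, ← star_mulVec, hC.eq]
    rfl
  have hcorner : (Matrix.of fun (_ : Fin 1) (_ : Fin 1) => star h ⬝ᵥ C *ᵥ h - t - r) *ᵥ
      (fun _ => s) = fun _ => (star h ⬝ᵥ C *ᵥ h - t - r) * s := by
    ext
    simp [mulVec, dotProduct]
  have hstar : star (Sum.elim y fun _ : Fin 1 => s) = Sum.elim (star y) fun _ => star s := by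
    ext (i | i) <;> rfl
  rw [fromBlocks_mulVec, hstar, sumElim_dotProduct_sumElim]
  simp only [Sum.elim_comp_inl, Sum.elim_comp_inr, hcol, hrow, hcorner, add_mulVec, smul_mulVec,
    one_mulVec, mulVec_add, mulVec_smul, star_add, star_smul, add_dotProduct, dotProduct_add,
    smul_dotProduct, dotProduct_smul, smul_eq_mul]
  simp [dotProduct]
  ring

/-- The bordered matrix `[[μI + C, Ch], [(Ch)*, h*Ch − t − μr]]` is positive semidefinite iff
the corresponding inhomogeneous quadratic form is nonnegative. -/
theorem PosSemidef.fromBlocks_border_iff [DecidableEq n] {C : Matrix n n ℂ}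
    (hC : C.PosSemidef) (h : n → ℂ) {μ : ℝ} (hμ : 0 ≤ μ) (t r : ℝ) :
    (Matrix.fromBlocks ((μ : ℂ) • (1 : Matrix n n ℂ) + C)
        (Matrix.of fun k (_ : Fin 1) => (C *ᵥ h) k)
        (Matrix.of fun (_ : Fin 1) k => star ((C *ᵥ h) k))
        (Matrix.of fun (_ : Fin 1) (_ : Fin 1) =>
          star h ⬝ᵥ C *ᵥ h - (t : ℂ) - ((μ * r : ℝ) : ℂ))).PosSemidef ↔
      ∀ y : n → ℂ, 0 ≤ (star (h + y) ⬝ᵥ C *ᵥ (h + y)).re - t + μ * (∑ k, ‖y k‖ ^ 2 - r) := by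
  have key (y : n → ℂ) : star (h + y) ⬝ᵥ C *ᵥ (h + y) + μ * (star y ⬝ᵥ y) - (t + (μ * r : ℝ)) =
      (((star (h + y) ⬝ᵥ C *ᵥ (h + y)).re - t + μ * (∑ k, ‖y k‖ ^ 2 - r) : ℝ) : ℂ) := by
    rw [star_dotProduct_self_eq_sum_norm_sq]
    push_cast [hC.coe_re_dotProduct_mulVec]
    ring
  constructor
  · intro hM y
    have := hM.dotProduct_mulVec_nonneg (Sum.elim y fun _ => 1)
    rw [hC.isHermitian.dotProduct_fromBlocks_mulVec, one_smul, star_one, one_mul, one_mul,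
      key] at this
    exact_mod_cast this
  · intro hq
    refine .of_dotProduct_mulVec_nonneg ?_ fun x => ?_
    · have := hC.isHermitian.fromBlocks_border (C *ᵥ h) μ
        ((star h ⬝ᵥ C *ᵥ h).re - t - μ * r)
      rwa [Complex.ofReal_sub, Complex.ofReal_sub, hC.coe_re_dotProduct_mulVec] at this
    · obtain ⟨y, s, rfl⟩ : ∃ (y : n → ℂ) (s : ℂ), x = Sum.elim y fun _ => s :=
        ⟨x ∘ Sum.inl, x (Sum.inr 0), by
          ext (i | i)
          · rfl
          · rw [Subsingleton.elim i 0]; rfl⟩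
      rw [hC.isHermitian.dotProduct_fromBlocks_mulVec]
      rcases eq_or_ne s 0 with rfl | hs
      · rw [star_zero, zero_mul, zero_mul, sub_zero, zero_smul, zero_add]
        exact add_nonneg (hC.dotProduct_mulVec_nonneg y)
          (mul_nonneg (by exact_mod_cast hμ) (dotProduct_star_self_nonneg y))
      · obtain ⟨z, rfl⟩ : ∃ z, y = s • z := ⟨s⁻¹ • y, by rw [smul_inv_smul₀ hs]⟩
        have : star (s • h + s • z) ⬝ᵥ C *ᵥ (s • h + s • z) + μ * (star (s • z) ⬝ᵥ (s • z)) -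
            star s * s * (t + (μ * r : ℝ)) = star s * s *
            (star (h + z) ⬝ᵥ C *ᵥ (h + z) + μ * (star z ⬝ᵥ z) - (t + (μ * r : ℝ))) := by
          rw [← smul_add]
          simp only [star_smul, mulVec_smul, smul_dotProduct, dotProduct_smul, smul_eq_mul]
          ring
        rw [this, key]
        exact mul_nonneg (star_mul_self_nonneg s) (by exact_mod_cast hq z)

end Matrix

/-- Lemma 1 of the paper: for a PSD Hermitian `C`, estimated channel `h`, error
radius `ε > 0` and threshold `t`, the robust energy constraint
`∀ η, ‖η‖ ≤ ε → (h+η)* C (h+η) ≥ t` holds iff there exists `μ ≥ 0` such that the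
Hermitian block matrix `[[μI + C, Ch], [(Ch)*, h*Ch − t − με²]]` is PSD. -/
theorem robust_energy_constraint_iff_LMI (K : ℕ) (hK : 0 < K)
    (C : Matrix (Fin K) (Fin K) ℂ) (hC : C.PosSemidef) (h : Fin K → ℂ)
    (ε : ℝ) (hε : 0 < ε) (t : ℝ) :
    (∀ η : Fin K → ℂ, Real.sqrt (∑ k, ‖η k‖ ^ 2) ≤ ε →
        (t : ℂ) ≤ star (h + η) ⬝ᵥ C *ᵥ (h + η)) ↔
      ∃ μ : ℝ, 0 ≤ μ ∧
        (Matrix.fromBlocks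
            ((μ : ℂ) • (1 : Matrix (Fin K) (Fin K) ℂ) + C)
            (Matrix.of fun k (_ : Fin 1) => (C *ᵥ h) k)
            (Matrix.of fun (_ : Fin 1) k => star ((C *ᵥ h) k))
            (Matrix.of fun (_ : Fin 1) (_ : Fin 1) =>
              star h ⬝ᵥ C *ᵥ h - (t : ℂ) - ((μ * ε ^ 2 : ℝ) : ℂ))).PosSemidef := by
  have hsqrt (η : Fin K → ℂ) : Real.sqrt (∑ k, ‖η k‖ ^ 2) ≤ ε ↔ ∑ k, ‖η k‖ ^ 2 - ε ^ 2 ≤ 0 := by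
    rw [Real.sqrt_le_left hε.le, sub_nonpos]
  have hre (η : Fin K → ℂ) : (t : ℂ) ≤ star (h + η) ⬝ᵥ C *ᵥ (h + η) ↔
      0 ≤ (star (h + η) ⬝ᵥ C *ᵥ (h + η)).re - t := by
    rw [← hC.coe_re_dotProduct_mulVec, Complex.real_le_real, Complex.ofReal_re, sub_nonneg]
  simp only [hsqrt, hre]
  rw [exists_congr fun μ => and_congr_right fun hμ => hC.fromBlocks_border_iff h hμ t (ε ^ 2)]
  constructor
  · intro H
    refine ConvexOn.exists_multiplier_of_slater (x₀ := 0) ?_ ?_ ?_ H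
    · exact (hC.convexOn_re_dotProduct_mulVec.translate_right h).sub
        (concaveOn_const t convex_univ)
    · exact convexOn_sum_norm_sq.sub (concaveOn_const (ε ^ 2) convex_univ)
    · simpa using pow_pos hε 2
  · rintro ⟨μ, hμ, H⟩ η hη
    linarith [H η, mul_nonpos_of_nonneg_of_nonpos hμ hη]
end

section
/- (S-procedure over ℂ^n.) Let n be a positive natural number, and for g = 1, 2 let A_g be an n×n complex Hermitian matrix, b_g ∈ ℂ^n, c_g ∈ ℝ, and define the real-valued quadratic functions f_g(η) = η* A_g η + 2·Re(b_g* η) + c_g on ℂ^n. Assume there exists η̂ ∈ ℂ^n with f_1(η̂) < 0 (strict feasibility). Then the implication 'for all η ∈ ℂ^n, f_1(η) ≤ 0 implies f_2(η) ≤ 0' holds if and only if there exists a real μ ≥ 0 such that μ·M_1 − M_2 is positive semidefinite, where M_g is the (n+1)×(n+1) Hermitian block matrix [[ A_g , b_g ], [ b_g* , c_g ]]. -/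
open Matrix Finset
open scoped ComplexOrder

/-- The real part of the quadratic form `v* M v` of a complex matrix. -/
def reQuadForm {m : Type*} [Fintype m] (M : Matrix m m ℂ) (v : m → ℂ) : ℝ :=
  (star v ⬝ᵥ M *ᵥ v).re

section reQuadForm

variable {m : Type*} [Fintype m] {M P Q : Matrix m m ℂ}

theorem reQuadForm_smul (M : Matrix m m ℂ) (a : ℂ) (v : m → ℂ) :
    reQuadForm M (a • v) = Complex.normSq a * reQuadForm M v := by
  simp only [reQuadForm, star_smul, mulVec_smul, smul_dotProduct, dotProduct_smul, smul_eq_mul]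
  rw [← mul_assoc, Complex.star_def, Complex.mul_conj, Complex.re_ofReal_mul]

theorem reQuadForm_add (hM : M.IsHermitian) (x y : m → ℂ) :
    reQuadForm M (x + y) =
      reQuadForm M x + reQuadForm M y + 2 * (star x ⬝ᵥ M *ᵥ y).re := by
  have h : (star y ⬝ᵥ M *ᵥ x).re = (star x ⬝ᵥ M *ᵥ y).re := by
    rw [star_dotProduct, star_mulVec, hM.eq, ← dotProduct_mulVec, Complex.star_def,
      Complex.conj_re]
  simp only [reQuadForm, star_add, mulVec_add, add_dotProduct, dotProduct_add, Complex.add_re, h]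
  ring

theorem reQuadForm_add_smul (hM : M.IsHermitian) (x y : m → ℂ) (a : ℂ) :
    reQuadForm M (x + a • y) = reQuadForm M x + Complex.normSq a * reQuadForm M y
      + 2 * (a * (star x ⬝ᵥ M *ᵥ y)).re := by
  rw [reQuadForm_add hM, reQuadForm_smul, mulVec_smul, dotProduct_smul, smul_eq_mul]

/-- A complex number can be rotated onto the imaginary axis. -/
theorem exists_normSq_eq_one_re_mul_eq_zero (z : ℂ) :
    ∃ a : ℂ, Complex.normSq a = 1 ∧ (a * z).re = 0 := by
  rcases eq_or_ne z 0 with rfl | hz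
  · exact ⟨1, by simp, by simp⟩
  · have hn : (‖z‖ : ℝ) ≠ 0 := norm_ne_zero_iff.2 hz
    refine ⟨Complex.I * star z / (‖z‖ : ℝ), ?_, ?_⟩
    · rw [Complex.normSq_eq_norm_sq]
      simp [hn]
    · rw [div_mul_eq_mul_div, Complex.div_ofReal_re, mul_assoc, Complex.star_def,
        ← Complex.normSq_eq_conj_mul_self]
      simp

theorem reQuadForm_mul_sub_mul_nonpos (hP : P.IsHermitian) (hQ : Q.IsHermitian)
    (h : ∀ v, reQuadForm P v ≤ 0 → reQuadForm Q v ≤ 0) {u w : m → ℂ}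
    (hu : 0 < reQuadForm P u) (hw : reQuadForm P w < 0) :
    reQuadForm P u * reQuadForm Q w - reQuadForm P w * reQuadForm Q u ≤ 0 := by
  obtain ⟨a, ha, hre⟩ := exists_normSq_eq_one_re_mul_eq_zero (star u ⬝ᵥ P *ᵥ w)
  set r : ℝ := √(reQuadForm P u / -reQuadForm P w)
  have hr : r * r = reQuadForm P u / -reQuadForm P w :=
    Real.mul_self_sqrt (div_nonneg hu.le (neg_nonneg.2 hw.le))
  have key : ∀ s : ℝ, s * s = r * r →
      reQuadForm Q u + s * s * reQuadForm Q w + 2 * (s * (a * (star u ⬝ᵥ Q *ᵥ w)).re) ≤ 0 := by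
    intro s hs
    have hQ' := h (u + ((s : ℂ) * a) • w) (by
      rw [reQuadForm_add_smul hP, mul_assoc, Complex.re_ofReal_mul, hre, Complex.normSq_mul, ha,
        Complex.normSq_ofReal, hs, hr, mul_one, div_neg, neg_mul, div_mul_cancel₀ _ hw.ne]
      simp)
    rwa [reQuadForm_add_smul hQ, mul_assoc, Complex.re_ofReal_mul, Complex.normSq_mul, ha,
      Complex.normSq_ofReal, mul_one] at hQ'
  have h₁ := key r rfl
  have h₂ := key (-r) (by ring)
  have h₃ : reQuadForm Q u + r * r * reQuadForm Q w ≤ 0 := by linarith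
  have h₄ : r * r * -reQuadForm P w = reQuadForm P u := by
    rw [hr]; exact div_mul_cancel₀ _ (neg_pos.2 hw).ne'
  calc reQuadForm P u * reQuadForm Q w - reQuadForm P w * reQuadForm Q u
      = -reQuadForm P w * (reQuadForm Q u + r * r * reQuadForm Q w) := by rw [← h₄]; ring
    _ ≤ 0 := mul_nonpos_of_nonneg_of_nonpos (neg_pos.2 hw).le h₃

/-- The homogeneous S-lemma for Hermitian forms. -/
theorem exists_reQuadForm_le_mul (hP : P.IsHermitian) (hQ : Q.IsHermitian)
    (h : ∀ v, reQuadForm P v ≤ 0 → reQuadForm Q v ≤ 0) (hfeas : ∃ w, reQuadForm P w < 0) :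
    ∃ μ : ℝ, 0 ≤ μ ∧ ∀ v, reQuadForm Q v ≤ μ * reQuadForm P v := by
  set S : Set ℝ := insert 0 ((fun u => reQuadForm Q u / reQuadForm P u) '' {u | 0 < reQuadForm P u})
  have hub : ∀ w, reQuadForm P w < 0 → reQuadForm Q w / reQuadForm P w ∈ upperBounds S := by
    rintro w hw _ (rfl | ⟨u, hu, rfl⟩)
    · exact div_nonneg_of_nonpos (h w hw.le) hw.le
    · have hu' : 0 < reQuadForm P u := hu
      have := reQuadForm_mul_sub_mul_nonpos hP hQ h hu' hw
      rw [le_div_iff_of_neg hw, div_mul_eq_mul_div, le_div_iff₀ hu']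
      linarith
  obtain ⟨w₀, hw₀⟩ := hfeas
  have hbdd : BddAbove S := ⟨_, hub w₀ hw₀⟩
  refine ⟨sSup S, le_csSup hbdd (Set.mem_insert _ _), fun v => ?_⟩
  rcases lt_trichotomy (reQuadForm P v) 0 with hv | hv | hv
  · exact (le_div_iff_of_neg hv).1 (csSup_le ⟨0, Set.mem_insert _ _⟩ (hub v hv))
  · simpa [hv] using h v hv.le
  · exact (div_le_iff₀ hv).1 (le_csSup hbdd (Set.mem_insert_of_mem _ ⟨v, hv, rfl⟩))

theorem nonpos_of_forall_quadratic_nonpos {p q r : ℝ}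
    (h : ∀ s : ℝ, 0 ≤ s → p + q * s + r * s ^ 2 ≤ 0) : r ≤ 0 := by
  by_contra! hr
  have hk : 0 ≤ (|p| + |q|) / r := by positivity
  set s := (|p| + |q|) / r + 1 with hs
  have hrs : r * s = |p| + |q| + r := by rw [hs]; field_simp
  have h₁ : r * s ^ 2 = (|p| + |q| + r) * s := by rw [← hrs]; ring
  have := h s (by linarith)
  nlinarith [neg_abs_le p, neg_abs_le q, abs_nonneg p, abs_nonneg q]

/-- If nonpositivity of `P` forces nonpositivity of `Q` along every ray from a strictly feasible
point `w` in the direction `±u`, then it does so in the direction `u` itself. -/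
theorem reQuadForm_nonpos_of_ray (hP : P.IsHermitian) (hQ : Q.IsHermitian) {u w : m → ℂ}
    (hw : reQuadForm P w < 0) (hu : reQuadForm P u ≤ 0)
    (h : ∀ s : ℝ, reQuadForm P (w + (s : ℂ) • u) ≤ 0 → reQuadForm Q (w + (s : ℂ) • u) ≤ 0) :
    reQuadForm Q u ≤ 0 := by
  simp only [reQuadForm_add_smul hP, reQuadForm_add_smul hQ, Complex.re_ofReal_mul,
    Complex.normSq_ofReal] at h
  rcases le_total (star w ⬝ᵥ P *ᵥ u).re 0 with hc | hc
  · refine nonpos_of_forall_quadratic_nonpos (p := reQuadForm Q w)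
      (q := 2 * (star w ⬝ᵥ Q *ᵥ u).re) fun s hs => ?_
    have := h s (by
      linarith [mul_nonpos_of_nonneg_of_nonpos hs hc,
        mul_nonpos_of_nonneg_of_nonpos (mul_self_nonneg s) hu])
    linarith
  · refine nonpos_of_forall_quadratic_nonpos (p := reQuadForm Q w)
      (q := -(2 * (star w ⬝ᵥ Q *ᵥ u).re)) fun s hs => ?_
    have := h (-s) (by
      linarith [mul_nonneg hs hc, mul_nonpos_of_nonneg_of_nonpos (mul_self_nonneg s) hu])
    linarith

theorem posSemidef_iff_reQuadForm_nonneg (hM : M.IsHermitian) :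
    M.PosSemidef ↔ ∀ v, 0 ≤ reQuadForm M v := by
  rw [posSemidef_iff_dotProduct_mulVec]
  refine ⟨fun h v => (Complex.nonneg_iff.1 (h.2 v)).1, fun h => ⟨hM, fun v => ?_⟩⟩
  exact Complex.nonneg_iff.2 ⟨h v, (hM.im_star_dotProduct_mulVec_self v).symm⟩

theorem reQuadForm_smul_sub (P Q : Matrix m m ℂ) (μ : ℝ) (v : m → ℂ) :
    reQuadForm ((μ : ℂ) • P - Q) v = μ * reQuadForm P v - reQuadForm Q v := by
  simp [reQuadForm, sub_mulVec, smul_mulVec, dotProduct_sub, dotProduct_smul]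

end reQuadForm

/-- The S-procedure over `ℂ^n`: for Hermitian `A g`, vectors `b g` and scalars
`c g` (`g = 0, 1`), with real-valued quadratic functions
`f g η = Re(η* (A g) η) + 2 Re((b g)* η) + c g`, if `f 0` is strictly feasible,
then `(∀ η, f 0 η ≤ 0 → f 1 η ≤ 0)` holds iff there exists `μ ≥ 0` with
`μ·M 0 − M 1` positive semidefinite, where `M g = [[A g, b g], [(b g)*, c g]]`. -/
theorem s_procedure_complex (n : ℕ) (hn : 0 < n)
    (A : Fin 2 → Matrix (Fin n) (Fin n) ℂ) (b : Fin 2 → Fin n → ℂ) (c : Fin 2 → ℝ)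
    (hA : ∀ g, (A g).IsHermitian)
    (f : Fin 2 → (Fin n → ℂ) → ℝ)
    (hf : ∀ g η, f g η = (star η ⬝ᵥ (A g) *ᵥ η).re + 2 * (star (b g) ⬝ᵥ η).re + c g)
    (M : Fin 2 → Matrix (Fin n ⊕ Fin 1) (Fin n ⊕ Fin 1) ℂ)
    (hM : ∀ g, M g = Matrix.fromBlocks
        (A g)
        (Matrix.of fun k (_ : Fin 1) => b g k)
        (Matrix.of fun (_ : Fin 1) k => star (b g k))
        (Matrix.of fun (_ : Fin 1) (_ : Fin 1) => ((c g : ℝ) : ℂ)))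
    (hfeas : ∃ η₀ : Fin n → ℂ, f 0 η₀ < 0) :
    (∀ η : Fin n → ℂ, f 0 η ≤ 0 → f 1 η ≤ 0) ↔
      ∃ μ : ℝ, 0 ≤ μ ∧ ((μ : ℂ) • M 0 - M 1).PosSemidef := by
  have hMh : ∀ g, (M g).IsHermitian := fun g => by
    rw [hM g]
    refine IsHermitian.fromBlocks (hA g) ?_ ?_
    · ext i j
      simp
    · ext i j
      simp
  have hfM : ∀ g η, reQuadForm (M g) (Sum.elim η fun _ => 1) = f g η := fun g η => by
    have hstar : star (Sum.elim η fun _ : Fin 1 => (1 : ℂ)) =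
        Sum.elim (star η) fun _ => 1 := by
      ext (i | i) <;> simp
    have hcol : ((of fun k (_ : Fin 1) => b g k) *ᵥ fun _ => (1 : ℂ)) = b g := by
      ext i
      simp [mulVec, dotProduct]
    have hconj : (star η ⬝ᵥ b g).re = (star (b g) ⬝ᵥ η).re := by
      rw [← Complex.conj_re, ← Complex.star_def, star_dotProduct, star_star]
    have hrow : (of fun (_ : Fin 1) k => star (b g k)) *ᵥ η = fun _ => star (b g) ⬝ᵥ η := rfl
    rw [hf, reQuadForm, hM g, fromBlocks_mulVec, hstar]
    simp only [Sum.elim_comp_inl, Sum.elim_comp_inr, sumElim_dotProduct_sumElim, hcol, hrow,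
      dotProduct_add, Complex.add_re, hconj]
    simp [mulVec, dotProduct]
    ring
  have hsub : ∀ μ : ℝ, ((μ : ℂ) • M 0 - M 1).IsHermitian := fun μ =>
    ((hMh 0).smul (Complex.conj_ofReal μ)).sub (hMh 1)
  simp only [posSemidef_iff_reQuadForm_nonneg (hsub _), reQuadForm_smul_sub, sub_nonneg]
  constructor
  · intro h
    obtain ⟨η₀, hη₀⟩ := hfeas
    rw [← hfM] at hη₀
    refine exists_reQuadForm_le_mul (hMh 0) (hMh 1) (fun v hv => ?_) ⟨_, hη₀⟩
    by_cases ht : v (Sum.inr 0) = 0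
    · refine reQuadForm_nonpos_of_ray (hMh 0) (hMh 1) hη₀ hv fun s => ?_
      have hs : (Sum.elim η₀ fun _ => 1) + (s : ℂ) • v =
          Sum.elim (η₀ + (s : ℂ) • (v ∘ Sum.inl)) fun _ => 1 := by
        ext (i | i)
        · simp
        · simp [Subsingleton.elim i 0, ht]
      rw [hs, hfM, hfM]
      exact h _
    · have hv' : v = v (Sum.inr 0) •
          Sum.elim ((v (Sum.inr 0))⁻¹ • (v ∘ Sum.inl)) fun _ => 1 := by
        ext (i | i)
        · simp [ht]
        · simp [Subsingleton.elim i 0]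
      have hpos : 0 < Complex.normSq (v (Sum.inr 0)) := Complex.normSq_pos.2 ht
      rw [hv', reQuadForm_smul, hfM] at hv ⊢
      exact mul_nonpos_of_nonneg_of_nonpos hpos.le
        (h _ (nonpos_of_mul_nonpos_right hv hpos))
  · rintro ⟨μ, hμ, h⟩ η hη
    have := h (Sum.elim η fun _ => 1)
    rw [hfM, hfM] at this
    exact this.trans (mul_nonpos_of_nonneg_of_nonpos hμ hη)
end
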